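/- arXiv:2005.13620 — 2 statements merged into one kernel-verified Lean document; each statement's English description precedes it below -/
import Mathlib

section
/- For |q| < 1, the double sum ∑_{n₁,n₂≥0} q^{n₁+n₂+n₁n₂} / ((q;q)_{n₁}² (q;q)_{n₂}²) equals (q;q⁵)_∞ (q⁴;q⁵)_∞ (q⁵;q⁵)_∞ / (q;q)_∞³. -/
/-- The finite q-Pochhammer symbol `(q;q)_n`. -/
noncomputable def qPoch (q : ℂ) (n : ℕ) : ℂ := ∏ i ∈ Finset.range n, (1 - q ^ (i + 1))

/-- The infinite q-Pochhammer symbol `(q;q)_∞`. -/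
noncomputable def qPochInf (q : ℂ) : ℂ := ∏' i : ℕ, (1 - q ^ (i + 1))

/-- The infinite q-Pochhammer symbol `(a;q)_∞ = ∏_{i≥0} (1 - a q^i)`. -/
noncomputable def pochInf (a q : ℂ) : ℂ := ∏' i : ℕ, (1 - a * q ^ i)

noncomputable def ri (q : ℂ) (n : ℕ) : ℂ := (qPoch q n)⁻¹

lemma one_sub_ne {q : ℂ} (hq : ‖q‖ < 1) (n : ℕ) : 1 - q ^ (n + 1) ≠ 0 := by
  intro h
  have h1 : q ^ (n + 1) = 1 := (sub_eq_zero.mp h).symm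
  have h2 : ‖q‖ ^ (n + 1) = 1 := by rw [← norm_pow, h1, norm_one]
  have h3 : ‖q‖ ^ (n + 1) < 1 := pow_lt_one₀ (norm_nonneg _) hq (by omega)
  linarith

lemma qPoch_ne {q : ℂ} (hq : ‖q‖ < 1) (n : ℕ) : qPoch q n ≠ 0 :=
  Finset.prod_ne_zero_iff.mpr fun i _ => one_sub_ne hq i

lemma ri_zero (q : ℂ) : ri q 0 = 1 := by simp [ri, qPoch]

lemma qPoch_succ (q : ℂ) (n : ℕ) : qPoch q (n + 1) = qPoch q n * (1 - q ^ (n + 1)) := by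
  simp [qPoch, Finset.prod_range_succ]

lemma ri_succ {q : ℂ} (hq : ‖q‖ < 1) (n : ℕ) : (1 - q ^ (n + 1)) * ri q (n + 1) = ri q n := by
  have h1 := one_sub_ne hq n
  have h2 := qPoch_ne hq n
  rw [ri, ri, qPoch_succ]
  field_simp

lemma pascal_sum {q : ℂ} (hq : ‖q‖ < 1) (g : ℕ → ℂ) (n : ℕ) :
    (1 - q ^ (n + 1)) * ∑ k ∈ Finset.range (n + 2), g k * ri q k * ri q (n + 1 - k)
      = ∑ k ∈ Finset.range (n + 1), (g k + q ^ (n - k) * g (k + 1)) * ri q k * ri q (n - k) := by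
  have h1 : (1 - q ^ (n + 1)) * ∑ k ∈ Finset.range (n + 2), g k * ri q k * ri q (n + 1 - k)
      = ∑ k ∈ Finset.range (n + 2), g k * ri q k * ((1 - q ^ (n + 1 - k)) * ri q (n + 1 - k))
        + ∑ k ∈ Finset.range (n + 2),
          g k * q ^ (n + 1 - k) * ((1 - q ^ k) * ri q k) * ri q (n + 1 - k) := by
    rw [← Finset.sum_add_distrib, Finset.mul_sum]
    refine Finset.sum_congr rfl fun k hk => ?_
    have hk' : k ≤ n + 1 := by have := Finset.mem_range.mp hk; omega
    have : q ^ (n + 1) = q ^ (n + 1 - k) * q ^ k := by rw [← pow_add]; congr 1; omega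
    rw [this]; ring
  rw [h1, Finset.sum_range_succ, Finset.sum_range_succ' _ (n + 1)]
  simp only [Nat.sub_self, pow_zero, sub_self, zero_mul, mul_zero, add_zero]
  rw [← Finset.sum_add_distrib]
  refine Finset.sum_congr rfl fun k hk => ?_
  have hk' : k ≤ n := by have := Finset.mem_range.mp hk; omega
  have e1 : n + 1 - k = (n - k) + 1 := by omega
  have e2 : n + 1 - (k + 1) = n - k := by omega
  rw [e1, e2, ri_succ hq, ri_succ hq]
  ring

lemma vander {q : ℂ} (hq : ‖q‖ < 1) (n : ℕ) : ∀ a : ℕ,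
    ∑ k ∈ Finset.range (n + 1), q ^ (k * (k + a)) * ri q k * ri q (k + a) * ri q (n - k)
      = ri q n * ri q (n + a) := by
  induction n with
  | zero => intro a; simp [ri_zero]
  | succ n ih =>
    intro a
    have h := pascal_sum hq (fun k => q ^ (k * (k + a)) * ri q (k + a)) n
    have h0 := one_sub_ne hq n
    apply mul_left_cancel₀ h0
    have e : ∑ k ∈ Finset.range (n + 1 + 1),
        q ^ (k * (k + a)) * ri q k * ri q (k + a) * ri q (n + 1 - k)
        = ∑ k ∈ Finset.range (n + 2),
        q ^ (k * (k + a)) * ri q (k + a) * ri q k * ri q (n + 1 - k) :=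
      Finset.sum_congr rfl fun k _ => by ring
    rw [e, h]
    have e2 : ∑ k ∈ Finset.range (n + 1), (q ^ (k * (k + a)) * ri q (k + a) +
        q ^ (n - k) * (q ^ ((k + 1) * (k + 1 + a)) * ri q (k + 1 + a))) * ri q k * ri q (n - k)
        = ri q n * ri q (n + a) + q ^ (n + 1 + a) * (ri q n * ri q (n + (a + 1))) := by
      rw [← ih a, ← ih (a + 1), Finset.mul_sum, ← Finset.sum_add_distrib]
      refine Finset.sum_congr rfl fun k hk => ?_
      have hk' : k ≤ n := by have := Finset.mem_range.mp hk; omega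
      obtain ⟨d, rfl⟩ := Nat.exists_eq_add_of_le hk'
      have e3 : k + 1 + a = k + (a + 1) := by ring
      rw [e3, Nat.add_sub_cancel_left]
      ring
    rw [e2]
    have e4 := ri_succ hq (n + a)
    have e5 := ri_succ hq n
    have e6 : n + 1 + a = n + a + 1 := by ring
    have e7 : n + (a + 1) = n + a + 1 := by ring
    rw [e6, e7, ← mul_assoc (1 - q ^ (n + 1)), e5, ← e4]
    ring

lemma qbin {q : ℂ} (hq : ‖q‖ < 1) (w : ℂ) (v : ℕ → ℂ) (hv : ∀ k, v (k + 1) = -w * q ^ k * v k)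
    (N : ℕ) : ∑ k ∈ Finset.range (N + 1), v k * ri q k * ri q (N - k)
      = v 0 * (∏ i ∈ Finset.range N, (1 - w * q ^ i)) * ri q N := by
  induction N with
  | zero => simp [ri_zero]
  | succ n ih =>
    apply mul_left_cancel₀ (one_sub_ne hq n)
    rw [pascal_sum hq v n]
    have : ∑ k ∈ Finset.range (n + 1), (v k + q ^ (n - k) * v (k + 1)) * ri q k * ri q (n - k)
      = (1 - w * q ^ n) * ∑ k ∈ Finset.range (n + 1), v k * ri q k * ri q (n - k) := by
      rw [Finset.mul_sum]
      refine Finset.sum_congr rfl fun k hk => ?_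
      have hk' : k ≤ n := by have := Finset.mem_range.mp hk; omega
      have : q ^ n = q ^ (n - k) * q ^ k := by rw [← pow_add]; congr 1; omega
      rw [hv, this]; ring
    rw [this, ih, Finset.prod_range_succ, ← ri_succ hq n]
    ring

noncomputable def cc (x y p : ℂ) (j : ℕ) : ℂ :=
  (-y) ^ j * p ^ (j.choose 2) + (-x) ^ (j + 1) * p ^ ((j + 1).choose 2)

lemma choose2 (j : ℕ) : (j + 1).choose 2 = j.choose 2 + j := by
  rw [Nat.choose_succ_succ' j 1, Nat.choose_one_right]; ring

lemma flip_prod {x y p : ℂ} (hp0 : p ≠ 0) (hxy : x * y = p) (m : ℕ) :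
    (-x) ^ m * p ^ (m.choose 2) * ∏ i ∈ Finset.range m, (1 - y / p ^ m * p ^ i)
      = ∏ i ∈ Finset.range m, (1 - x * p ^ i) := by
  induction m with
  | zero => simp
  | succ m ih =>
    rw [Finset.prod_range_succ', Finset.prod_range_succ _ m, ← ih]
    have : ∀ i, 1 - y / p ^ (m + 1) * p ^ (i + 1) = 1 - y / p ^ m * p ^ i := by
      intro i; field_simp; ring
    simp only [this, choose2]
    have h2 : (-x) * p ^ m * (1 - y / p ^ (m + 1) * p ^ 0) = 1 - x * p ^ m := by
      field_simp
      rw [pow_succ, mul_sub, ← hxy]; ring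
    rw [← h2]; ring

lemma jtp {x y p : ℂ} (hp : ‖p‖ < 1) (hp0 : p ≠ 0) (hxy : x * y = p) (n : ℕ) :
    ∑ j ∈ Finset.range (n + 1), cc x y p j * ri p (n - j) * ri p (n + 1 + j)
      = (∏ i ∈ Finset.range (n + 1), (1 - x * p ^ i)) * (∏ i ∈ Finset.range n, (1 - y * p ^ i))
        * ri p (2 * n + 1) := by
  set v : ℕ → ℂ := fun k => if n + 1 ≤ k then (-y) ^ (k - (n + 1)) * p ^ ((k - (n + 1)).choose 2)
    else (-x) ^ (n + 1 - k) * p ^ ((n + 1 - k).choose 2) with hvdef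
  have hv : ∀ k, v (k + 1) = -(y / p ^ (n + 1)) * p ^ k * v k := by
    intro k
    by_cases h : n + 1 ≤ k
    · obtain ⟨d, rfl⟩ := Nat.exists_eq_add_of_le h
      have e1 : n + 1 + d + 1 - (n + 1) = d + 1 := by omega
      have e2 : n + 1 + d - (n + 1) = d := by omega
      have e3 : n + 1 ≤ n + 1 + d + 1 := by omega
      simp only [hvdef, h, e3, if_true, e1, e2, choose2]
      field_simp
      ring
    · have key : v (k + 1) = (-x) ^ (n - k) * p ^ ((n - k).choose 2) := by
        by_cases h' : n + 1 ≤ k + 1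
        · have : k = n := by omega
          subst this
          simp [hvdef]
        · have : n + 1 - (k + 1) = n - k := by omega
          simp only [hvdef, h', if_false, this]
      obtain ⟨d, hd⟩ : ∃ d, n = k + d := ⟨n - k, by omega⟩
      have e1 : n + 1 - k = d + 1 := by omega
      have e2 : n - k = d := by omega
      rw [key]
      simp only [hvdef, h, if_false, e1, e2, choose2]
      rw [hd]
      field_simp
      rw [← hxy]
      ring
  have h := qbin hp (y / p ^ (n + 1)) v hv (2 * n + 1)
  have hv0 : v 0 = (-x) ^ (n + 1) * p ^ ((n + 1).choose 2) := by simp [hvdef]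
  have hprod : ∏ i ∈ Finset.range (2 * n + 1), (1 - y / p ^ (n + 1) * p ^ i)
      = (∏ i ∈ Finset.range (n + 1), (1 - y / p ^ (n + 1) * p ^ i)) *
        ∏ i ∈ Finset.range n, (1 - y * p ^ i) := by
    have : 2 * n + 1 = (n + 1) + n := by ring
    rw [this, Finset.prod_range_add]
    congr 1
    refine Finset.prod_congr rfl fun i _ => ?_
    field_simp; ring
  rw [hprod, hv0, ← mul_assoc, flip_prod hp0 hxy] at h
  rw [← h]
  have e : 2 * n + 1 + 1 = (n + 1) + (n + 1) := by ring
  rw [e, Finset.sum_range_add (fun k => v k * ri p k * ri p (2 * n + 1 - k)) (n + 1) (n + 1), ← Finset.sum_range_reflect (fun k => v k * ri p k * ri p (2 * n + 1 - k)) (n + 1), ← Finset.sum_add_distrib]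
  refine Finset.sum_congr rfl fun j hj => ?_
  have hj' : j ≤ n := by have := Finset.mem_range.mp hj; omega
  have a1 : n + 1 - 1 - j = n - j := by omega
  have a2 : 2 * n + 1 - (n - j) = n + 1 + j := by omega
  have a3 : 2 * n + 1 - (n + 1 + j) = n - j := by omega
  have a4 : ¬ (n + 1 ≤ n - j) := by omega
  have a5 : n + 1 ≤ n + 1 + j := by omega
  have a6 : n + 1 - (n - j) = j + 1 := by omega
  have a7 : n + 1 + j - (n + 1) = j := by omega
  rw [a1, a2, a3]
  simp only [hvdef, a4, a5, if_true, if_false, a6, a7, cc]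
  ring

lemma bailey {q : ℂ} (hq : ‖q‖ < 1) (c : ℕ → ℂ) (N : ℕ) :
    ∑ n ∈ Finset.range (N + 1), q ^ (n ^ 2 + n) *
      (∑ j ∈ Finset.range (n + 1), c j * ri q (n - j) * ri q (n + 1 + j)) * ri q (N - n)
    = ∑ j ∈ Finset.range (N + 1), (q ^ (j ^ 2 + j) * c j) * ri q (N - j) * ri q (N + 1 + j) := by
  simp only [Finset.mul_sum, Finset.sum_mul]
  rw [Finset.sum_comm' (t' := Finset.range (N + 1)) (s' := fun j => Finset.Ico j (N + 1))
    (by intro a b; simp only [Finset.mem_range, Finset.mem_Ico]; omega)]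
  refine Finset.sum_congr rfl fun j hj => ?_
  have hj' : j ≤ N := by have := Finset.mem_range.mp hj; omega
  obtain ⟨d, rfl⟩ := Nat.exists_eq_add_of_le hj'
  rw [Finset.sum_Ico_eq_sum_range]
  have a1 : j + d + 1 - j = d + 1 := by omega
  have a2 : j + d - j = d := by omega
  have a3 : j + d + 1 + j = d + (2 * j + 1) := by ring
  rw [a1, a2, a3, mul_assoc, ← vander hq d (2 * j + 1), Finset.mul_sum]
  refine Finset.sum_congr rfl fun k hk => ?_
  have hk' : k ≤ d := by have := Finset.mem_range.mp hk; omega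
  have a4 : j + k - j = k := by omega
  have a5 : j + k + 1 + j = k + (2 * j + 1) := by ring
  have a6 : j + d - (j + k) = d - k := by omega
  rw [a4, a5, a6]
  ring

lemma sq_choose (j : ℕ) : j ^ 2 = 2 * j.choose 2 + j := by
  induction j with
  | zero => rfl
  | succ j ih => rw [choose2]; linarith [ih, (by ring : (j + 1) ^ 2 = j ^ 2 + 2 * j + 1)]

lemma finiteRR {q : ℂ} (hq : ‖q‖ < 1) (hq0 : q ≠ 0) (N : ℕ) :
    ∑ n ∈ Finset.range (N + 1), q ^ (n ^ 2 + n) * ri q n * ri q (N - n)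
    = ∑ j ∈ Finset.range (N + 1), cc q (q ^ 4) (q ^ 5) j * ri q (N - j) * ri q (N + 1 + j) := by
  have h0 : ∀ n, ∑ j ∈ Finset.range (n + 1), cc q 1 q j * ri q (n - j) * ri q (n + 1 + j)
      = if n = 0 then 1 else 0 := by
    intro n
    rw [jtp hq hq0 (mul_one q)]
    rcases n with _ | n
    · have := ri_succ hq 0
      rw [ri_zero] at this
      simpa using this
    · rw [Finset.prod_range_succ' _ n]; simp
  have h1 : ∀ n, ri q n = ∑ j ∈ Finset.range (n + 1),
      (q ^ (j ^ 2 + j) * cc q 1 q j) * ri q (n - j) * ri q (n + 1 + j) := by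
    intro n
    rw [← bailey hq]
    simp only [h0]
    rw [Finset.sum_range_succ']
    simp
  have h2 := bailey hq (fun j => q ^ (j ^ 2 + j) * cc q 1 q j) N
  simp only [← h1] at h2
  rw [h2]
  refine Finset.sum_congr rfl fun j _ => ?_
  congr 2
  have hj := sq_choose j
  simp only [cc, choose2]
  rw [hj, neg_pow (q ^ 4), neg_pow (1 : ℂ), neg_pow q, one_pow]
  ring

lemma summ_geo {a q : ℂ} (hq : ‖q‖ < 1) : Summable fun i : ℕ => ‖-(a * q ^ i)‖ := by
  simp only [norm_neg, norm_mul, norm_pow]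
  exact (summable_geometric_of_lt_one (norm_nonneg _) hq).mul_left _

lemma pochInf_tendsto {a q : ℂ} (hq : ‖q‖ < 1) :
    Filter.Tendsto (fun n => ∏ i ∈ Finset.range n, (1 - a * q ^ i)) Filter.atTop
      (nhds (pochInf a q)) := by
  have h := multipliable_one_add_of_summable (summ_geo (a := a) hq)
  simpa [pochInf, sub_eq_add_neg] using h.hasProd.tendsto_prod_nat

lemma qPochInf_eq (q : ℂ) : qPochInf q = pochInf q q := by
  simp only [qPochInf, pochInf, pow_succ']

lemma qPoch_tendsto {q : ℂ} (hq : ‖q‖ < 1) :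
    Filter.Tendsto (qPoch q) Filter.atTop (nhds (qPochInf q)) := by
  rw [qPochInf_eq]
  refine (pochInf_tendsto (a := q) hq).congr fun n => ?_
  simp only [qPoch, pow_succ']

lemma qPochInf_ne {q : ℂ} (hq : ‖q‖ < 1) : qPochInf q ≠ 0 := by
  have := tprod_one_add_ne_zero_of_summable (f := fun i : ℕ => -(q * q ^ i))
    (fun i => by have := one_sub_ne hq i; rwa [pow_succ', sub_eq_add_neg] at this) (summ_geo hq)
  simpa only [qPochInf, pow_succ', sub_eq_add_neg] using this

lemma ri_tendsto {q : ℂ} (hq : ‖q‖ < 1) :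
    Filter.Tendsto (ri q) Filter.atTop (nhds (qPochInf q)⁻¹) :=
  (qPoch_tendsto hq).inv₀ (qPochInf_ne hq)

lemma ri_bound {q : ℂ} (hq : ‖q‖ < 1) : ∃ C : ℝ, 0 < C ∧ ∀ n, ‖ri q n‖ ≤ C := by
  obtain ⟨C, hC, h⟩ := (Metric.isBounded_range_of_tendsto _ (ri_tendsto hq)).exists_pos_norm_le
  exact ⟨C, hC, fun n => h _ ⟨n, rfl⟩⟩

lemma tannery (c : ℕ → ℂ) (hc : Summable fun j => ‖c j‖) (W : ℕ → ℕ → ℂ) (K : ℝ)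
    (hK : ∀ n j, ‖W n j‖ ≤ K) (L : ℂ)
    (hW : ∀ j, Filter.Tendsto (fun n => W n j) Filter.atTop (nhds L)) :
    Filter.Tendsto (fun n => ∑ j ∈ Finset.range (n + 1), c j * W n j) Filter.atTop
      (nhds ((∑' j, c j) * L)) := by
  have h := tendsto_tsum_of_dominated_convergence (𝓕 := Filter.atTop)
    (f := fun n j => if j ∈ Finset.range (n + 1) then c j * W n j else 0)
    (g := fun j => c j * L) (hc.mul_right K)
    (fun j => by
      refine (((hW j).const_mul (c j))).congr' ?_
      filter_upwards [Filter.eventually_ge_atTop j] with n hn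
      rw [if_pos (Finset.mem_range.mpr (by omega))])
    (Filter.Eventually.of_forall fun n j => by
      have h0 : ‖c j * W n j‖ ≤ ‖c j‖ * K := by
        rw [norm_mul]; exact mul_le_mul_of_nonneg_left (hK n j) (norm_nonneg _)
      split_ifs
      · exact h0
      · rw [norm_zero]; exact (norm_nonneg _).trans h0)
  rw [tsum_mul_right] at h
  refine h.congr fun n => ?_
  rw [tsum_eq_sum (s := Finset.range (n + 1)) (fun j hj => if_neg hj)]
  exact Finset.sum_congr rfl fun j hj => if_pos hj

lemma tannery1 {q : ℂ} (hq : ‖q‖ < 1) (c : ℕ → ℂ) (hc : Summable fun j => ‖c j‖) :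
    Filter.Tendsto (fun n => ∑ j ∈ Finset.range (n + 1), c j * ri q (n - j)) Filter.atTop
      (nhds ((∑' j, c j) * (qPochInf q)⁻¹)) := by
  obtain ⟨C, hC, hb⟩ := ri_bound hq
  exact tannery c hc (fun n j => ri q (n - j)) C (fun n j => hb _) _
    (fun j => (ri_tendsto hq).comp (Filter.tendsto_sub_atTop_nat j))

lemma tannery2 {q : ℂ} (hq : ‖q‖ < 1) (c : ℕ → ℂ) (hc : Summable fun j => ‖c j‖) :
    Filter.Tendsto (fun n => ∑ j ∈ Finset.range (n + 1), c j * ri q (n - j) * ri q (n + 1 + j))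
      Filter.atTop (nhds ((∑' j, c j) * ((qPochInf q)⁻¹ * (qPochInf q)⁻¹))) := by
  obtain ⟨C, hC, hb⟩ := ri_bound hq
  simp only [mul_assoc]
  refine tannery c hc (fun n j => ri q (n - j) * ri q (n + 1 + j)) (C * C) (fun n j => ?_) _
    (fun j => ?_)
  · rw [norm_mul]; exact mul_le_mul (hb _) (hb _) (norm_nonneg _) hC.le
  · refine ((ri_tendsto hq).comp (Filter.tendsto_sub_atTop_nat j)).mul
      ((ri_tendsto hq).comp ?_)
    exact Filter.tendsto_atTop_mono (fun n => by simp only [id]; omega) Filter.tendsto_id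

lemma norm_le_geo {q : ℂ} (hq : ‖q‖ < 1) {a b : ℕ} (h : b ≤ a) : ‖q ^ a‖ ≤ ‖q‖ ^ b := by
  rw [norm_pow]; exact pow_le_pow_of_le_one (norm_nonneg _) hq.le h

lemma cc_summable {q : ℂ} (hq : ‖q‖ < 1) : Summable fun j => ‖cc q (q ^ 4) (q ^ 5) j‖ := by
  refine Summable.of_nonneg_of_le (fun j => norm_nonneg _) (fun j => ?_)
    ((summable_geometric_of_lt_one (norm_nonneg q) hq).mul_left 2)
  have h1 : ‖(-q ^ 4) ^ j * (q ^ 5) ^ (j.choose 2)‖ ≤ ‖q‖ ^ j := by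
    rw [norm_mul, norm_pow, norm_neg, ← norm_pow, ← norm_mul, ← pow_mul, ← pow_mul, ← pow_add]
    exact norm_le_geo hq (by omega)
  have h2 : ‖(-q) ^ (j + 1) * (q ^ 5) ^ ((j + 1).choose 2)‖ ≤ ‖q‖ ^ j := by
    rw [norm_mul, norm_pow, norm_neg, ← norm_pow, ← norm_mul, ← pow_mul, ← pow_add]
    exact norm_le_geo hq (by omega)
  exact (norm_add_le _ _).trans (by linarith)

lemma jtpInf {q : ℂ} (hq : ‖q‖ < 1) (hq0 : q ≠ 0) :
    ∑' j, cc q (q ^ 4) (q ^ 5) j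
      = pochInf q (q ^ 5) * pochInf (q ^ 4) (q ^ 5) * pochInf (q ^ 5) (q ^ 5) := by
  have hp : ‖q ^ 5‖ < 1 := by rw [norm_pow]; exact pow_lt_one₀ (norm_nonneg _) hq (by norm_num)
  have h1 := tannery2 hp _ (cc_summable hq)
  have h2 : Filter.Tendsto (fun n => (∏ i ∈ Finset.range (n + 1), (1 - q * (q ^ 5) ^ i)) *
      (∏ i ∈ Finset.range n, (1 - q ^ 4 * (q ^ 5) ^ i)) * ri (q ^ 5) (2 * n + 1)) Filter.atTop
      (nhds (pochInf q (q ^ 5) * pochInf (q ^ 4) (q ^ 5) * (qPochInf (q ^ 5))⁻¹)) := by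
    refine Filter.Tendsto.mul (Filter.Tendsto.mul
      ((pochInf_tendsto hp).comp (Filter.tendsto_add_atTop_nat 1)) (pochInf_tendsto hp))
      ((ri_tendsto hp).comp ?_)
    exact Filter.tendsto_atTop_mono (fun n => by simp only [id]; omega) Filter.tendsto_id
  have h3 := tendsto_nhds_unique h1
    (h2.congr fun n => (jtp hp (pow_ne_zero 5 hq0) (by ring) n).symm)
  have h4 := qPochInf_ne hp
  rw [← qPochInf_eq]
  field_simp at h3
  rw [h3]; ring

lemma F_bound {q : ℂ} (hq : ‖q‖ < 1) (e : ℕ → ℕ) (he : ∀ n, n ≤ e n) (r : ℕ → ℂ) (C : ℝ)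
    (hr : ∀ n, ‖r n‖ ≤ C) : Summable fun n => ‖q ^ e n * r n‖ := by
  refine Summable.of_nonneg_of_le (fun j => norm_nonneg _) (fun j => ?_)
    ((summable_geometric_of_lt_one (norm_nonneg q) hq).mul_right C)
  rw [norm_mul]
  exact mul_le_mul (norm_le_geo hq (he j)) (hr j) (norm_nonneg _) (by positivity)

lemma RR2 {q : ℂ} (hq : ‖q‖ < 1) (hq0 : q ≠ 0) :
    ∑' n : ℕ, q ^ (n ^ 2 + n) * ri q n
      = pochInf q (q ^ 5) * pochInf (q ^ 4) (q ^ 5) * pochInf (q ^ 5) (q ^ 5) / qPochInf q := by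
  obtain ⟨C, hC, hb⟩ := ri_bound hq
  have h1 := tannery1 hq (fun n => q ^ (n ^ 2 + n) * ri q n)
    (F_bound hq (fun n => n ^ 2 + n) (fun n => by omega) _ C hb)
  have h2 := tannery2 hq _ (cc_summable hq)
  have h3 := tendsto_nhds_unique h1 (h2.congr fun n => (finiteRR hq hq0 n).symm)
  rw [jtpInf hq hq0] at h3
  have h4 := qPochInf_ne hq
  field_simp at h3 ⊢
  exact h3

lemma euler {q : ℂ} (hq : ‖q‖ < 1) (k : ℕ) :
    ∑' m : ℕ, q ^ ((k + 1) * m) * ri q m = qPoch q k * (qPochInf q)⁻¹ := by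
  obtain ⟨C, hC, hb⟩ := ri_bound hq
  have hs : ∀ k : ℕ, Summable fun m : ℕ => q ^ ((k + 1) * m) * ri q m := fun k =>
    (F_bound hq (fun m => (k + 1) * m) (fun n => by nlinarith [Nat.zero_le (k * n)]) _ C hb).of_norm
  set S : ℕ → ℂ := fun k => ∑' m : ℕ, q ^ ((k + 1) * m) * ri q m with hS
  have hrec : ∀ k, S (k + 1) = (1 - q ^ (k + 1)) * S k := by
    intro k
    have h1 : S k - S (k + 1) = q ^ (k + 1) * S k := by
      simp only [hS]
      rw [← (hs k).tsum_sub (hs (k + 1)),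
        ((hs k).sub (hs (k + 1))).tsum_eq_zero_add, ← tsum_mul_left]
      simp only [mul_zero, sub_self, zero_add]
      refine tsum_congr fun m => ?_
      rw [← ri_succ hq m]
      ring
    linear_combination -h1
  have h2 : ∀ k, S k = qPoch q k * S 0 := by
    intro k
    induction k with
    | zero => simp [qPoch]
    | succ k ih => rw [hrec, ih, qPoch_succ]; ring
  have h3 : Filter.Tendsto S Filter.atTop (nhds 1) := by
    have h := tendsto_tsum_of_dominated_convergence (𝓕 := Filter.atTop)
      (f := fun k m : ℕ => q ^ ((k + 1) * m) * ri q m)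
      (g := fun m => if m = 0 then 1 else 0)
      ((summable_geometric_of_lt_one (norm_nonneg q) hq).mul_right C)
      (fun m => by
        rcases m with _ | m
        · simp [ri_zero]
        · simp only [Nat.add_eq_zero_iff, one_ne_zero, and_false, if_false]
          have : Filter.Tendsto (fun k : ℕ => q ^ ((k + 1) * (m + 1))) Filter.atTop (nhds 0) :=
            (tendsto_pow_atTop_nhds_zero_of_norm_lt_one hq).comp
              (Filter.tendsto_atTop_mono (fun n => by
                show n ≤ _; nlinarith [Nat.zero_le (n * m)]) Filter.tendsto_id)
          simpa using this.mul_const (ri q (m + 1)))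
      (Filter.Eventually.of_forall fun k m => by
        rw [norm_mul]
        exact mul_le_mul (norm_le_geo hq (by nlinarith [Nat.zero_le (k * m)])) (hb m)
          (norm_nonneg _) (by positivity))
    simpa using h
  have h4 : Filter.Tendsto S Filter.atTop (nhds (qPochInf q * S 0)) :=
    ((qPoch_tendsto hq).mul_const (S 0)).congr fun k => (h2 k).symm
  have h5 := tendsto_nhds_unique h4 h3
  show S k = _
  rw [h2, eq_inv_of_mul_eq_one_right h5]

lemma inner_qsum {q : ℂ} (hq : ‖q‖ < 1) (m : ℕ) :
    ∑' n : ℕ, q ^ ((m + 1) * n) * ri q n ^ 2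
      = (∑' k : ℕ, q ^ (k ^ 2 + (m + 1) * k) * ri q k ^ 2) * (qPoch q m * (qPochInf q)⁻¹) := by
  obtain ⟨C, hC, hb⟩ := ri_bound hq
  have hb2 : ∀ n, ‖ri q n ^ 2‖ ≤ C ^ 2 := fun n => by
    rw [norm_pow]; exact pow_le_pow_left₀ (norm_nonneg _) (hb n) 2
  rw [← euler hq, tsum_mul_tsum_eq_tsum_sum_range_of_summable_norm
    (F_bound hq (fun k => k ^ 2 + (m + 1) * k)
      (fun n => by nlinarith [Nat.zero_le (m * n), Nat.zero_le (n ^ 2)]) _ _ hb2)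
    (F_bound hq (fun k => (m + 1) * k) (fun n => by nlinarith [Nat.zero_le (m * n)]) _ _ hb)]
  refine tsum_congr fun n => ?_
  have := vander hq n 0
  simp only [add_zero] at this
  rw [sq (ri q n), ← this, Finset.mul_sum]
  refine Finset.sum_congr rfl fun k hk => ?_
  have hk' : k ≤ n := by have := Finset.mem_range.mp hk; omega
  obtain ⟨d, rfl⟩ := Nat.exists_eq_add_of_le hk'
  rw [Nat.add_sub_cancel_left]
  ring

lemma summ2 {q : ℂ} (hq : ‖q‖ < 1) (e : ℕ × ℕ → ℕ) (he : ∀ n, n.1 + n.2 ≤ e n) (r : ℕ × ℕ → ℂ)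
    (C : ℝ) (hr : ∀ n, ‖r n‖ ≤ C) : Summable fun n => q ^ e n * r n := by
  have hg := summable_geometric_of_lt_one (norm_nonneg q) hq
  have h2 := (hg.mul_of_nonneg hg (fun _ => by positivity) (fun _ => by positivity)).mul_right C
  refine Summable.of_norm_bounded h2 fun n => ?_
  rw [norm_mul, ← pow_add]
  exact mul_le_mul (norm_le_geo hq (he n)) (hr n) (norm_nonneg _) (by positivity)

lemma double_sum {q : ℂ} (hq : ‖q‖ < 1) :
    ∑' n : ℕ × ℕ, q ^ (n.1 + n.2 + n.1 * n.2) * (ri q n.1 ^ 2 * ri q n.2 ^ 2)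
      = (∑' k : ℕ, q ^ (k ^ 2 + k) * ri q k) * (qPochInf q)⁻¹ ^ 2 := by
  obtain ⟨C, hC, hb⟩ := ri_bound hq
  have hb2 : ∀ n, ‖ri q n ^ 2‖ ≤ C ^ 2 := fun n => by
    rw [norm_pow]; exact pow_le_pow_left₀ (norm_nonneg _) (hb n) 2
  have hs1 := summ2 hq (fun n => n.1 + n.2 + n.1 * n.2) (fun n => by omega)
    (fun n => ri q n.1 ^ 2 * ri q n.2 ^ 2) (C ^ 2 * C ^ 2) (fun n => by
      rw [norm_mul]; exact mul_le_mul (hb2 _) (hb2 _) (norm_nonneg _) (by positivity))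
  have hs2 := summ2 hq (fun n => n.1 + n.2 + n.1 * n.2 + n.2 ^ 2) (fun n => by omega)
    (fun n => ri q n.1 * ri q n.2 ^ 2) (C * C ^ 2) (fun n => by
      rw [norm_mul]; exact mul_le_mul (hb _) (hb2 _) (norm_nonneg _) (by positivity))
  rw [hs1.tsum_prod]
  have h1 : ∀ m : ℕ, ∑' n : ℕ, q ^ (m + n + m * n) * (ri q m ^ 2 * ri q n ^ 2)
      = (∑' k : ℕ, q ^ (m + k + m * k + k ^ 2) * (ri q m * ri q k ^ 2)) * (qPochInf q)⁻¹ := by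
    intro m
    have h2 := inner_qsum hq m
    have h3 : ri q m * qPoch q m = 1 := inv_mul_cancel₀ (qPoch_ne hq m)
    calc _ = ∑' n : ℕ, (q ^ m * ri q m ^ 2) * (q ^ ((m + 1) * n) * ri q n ^ 2) :=
          tsum_congr fun n => by ring
      _ = (q ^ m * ri q m) * (∑' k : ℕ, q ^ (k ^ 2 + (m + 1) * k) * ri q k ^ 2) *
            (ri q m * qPoch q m) * (qPochInf q)⁻¹ := by rw [tsum_mul_left, h2]; ring
      _ = _ := by
          rw [h3, mul_one, ← tsum_mul_left]
          congr 1
          exact tsum_congr fun k => by ring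
  simp only [h1]
  rw [tsum_mul_right, ← Summable.tsum_comm (f := fun m k : ℕ =>
    q ^ (m + k + m * k + k ^ 2) * (ri q m * ri q k ^ 2)) hs2]
  have h4 : ∀ k : ℕ, ∑' m : ℕ, q ^ (m + k + m * k + k ^ 2) * (ri q m * ri q k ^ 2)
      = q ^ (k ^ 2 + k) * ri q k * (qPochInf q)⁻¹ := by
    intro k
    have h3 : ri q k * qPoch q k = 1 := inv_mul_cancel₀ (qPoch_ne hq k)
    calc _ = ∑' m : ℕ, (q ^ (k ^ 2 + k) * ri q k ^ 2) * (q ^ ((k + 1) * m) * ri q m) :=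
          tsum_congr fun n => by ring
      _ = q ^ (k ^ 2 + k) * ri q k * (ri q k * qPoch q k) * (qPochInf q)⁻¹ := by
          rw [tsum_mul_left, euler hq]; ring
      _ = _ := by rw [h3, mul_one]
  simp only [h4]
  rw [tsum_mul_right]
  ring

theorem stmt3 (q : ℂ) (hq : ‖q‖ < 1) :
    ∑' n : ℕ × ℕ, q ^ (n.1 + n.2 + n.1 * n.2) / (qPoch q n.1 ^ 2 * qPoch q n.2 ^ 2)
      = pochInf q (q ^ 5) * pochInf (q ^ 4) (q ^ 5) * pochInf (q ^ 5) (q ^ 5)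
          / qPochInf q ^ 3 := by
  by_cases hq0 : q = 0
  · subst hq0
    rw [tsum_eq_single (0, 0)]
    · simp [pochInf, qPochInf, qPoch]
    · rintro ⟨a, b⟩ h
      have : a + b + a * b ≠ 0 := by
        intro h'
        apply h
        have h1 : a = 0 := by omega
        have h2 : b = 0 := by omega
        rw [h1, h2]
      simp only [zero_pow this, zero_div]
  · have h := double_sum hq
    rw [RR2 hq hq0] at h
    have e : ∀ n : ℕ × ℕ, q ^ (n.1 + n.2 + n.1 * n.2) / (qPoch q n.1 ^ 2 * qPoch q n.2 ^ 2)
        = q ^ (n.1 + n.2 + n.1 * n.2) * (ri q n.1 ^ 2 * ri q n.2 ^ 2) := by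
      intro n
      rw [ri, ri, div_eq_mul_inv, mul_inv, inv_pow, inv_pow]
    simp only [e]
    rw [h]
    have h4 := qPochInf_ne hq
    field_simp
end

section
/- For |q| < 1, the triple sum ∑_{n₁,n₂,n₃≥0} q^{n₁+n₂+n₃+n₁n₂+n₂n₃} / ((q;q)_{n₁}² (q;q)_{n₂} (q;q)_{n₃}²) equals (1 + 2∑_{n≥1} (-1)ⁿ q^{n(n+1)/2}) / ((1-q)·(q;q)_∞⁴). -/
open Filter Topology

lemma aux_tele {f g : ℕ → ℂ} {L : ℂ} (hf : Summable f) (h : ∀ n, f n = g (n+1) - g n)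
    (hg : Tendsto g atTop (𝓝 L)) : ∑' n, f n = L - g 0 := by
  have h1 := hf.hasSum.tendsto_sum_nat
  have h2 : Tendsto (fun n => ∑ i ∈ Finset.range n, f i) atTop (𝓝 (L - g 0)) := by
    simp_rw [h, Finset.sum_range_sub]
    exact hg.sub_const _
  exact tendsto_nhds_unique h1 h2

lemma aux_succ (q : ℂ) (n : ℕ) : qPoch q (n+1) = qPoch q n * (1 - q^(n+1)) := by
  simp [qPoch, Finset.prod_range_succ]

lemma aux_one_sub_ne (q : ℂ) (hq : ‖q‖ < 1) (n : ℕ) : 1 - q^(n+1) ≠ 0 := by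
  intro h
  have h1 : ‖q^(n+1)‖ = 1 := by
    rw [← sub_eq_zero.mp h]; simp
  rw [norm_pow] at h1
  have := pow_lt_one₀ (norm_nonneg q) hq (Nat.succ_ne_zero n)
  simp at this
  linarith

lemma aux_ne (q : ℂ) (hq : ‖q‖ < 1) (n : ℕ) : qPoch q n ≠ 0 :=
  Finset.prod_ne_zero_iff.mpr fun i _ => aux_one_sub_ne q hq i

lemma aux_sum (q : ℂ) (hq : ‖q‖ < 1) : Summable (fun i : ℕ => ‖-q^(i+1)‖) := by
  simp only [norm_neg, norm_pow]
  exact (summable_nat_add_iff 1).mpr (summable_geometric_of_lt_one (norm_nonneg q) hq)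

lemma aux_inf_ne (q : ℂ) (hq : ‖q‖ < 1) : qPochInf q ≠ 0 := by
  have := tprod_one_add_ne_zero_of_summable (f := fun i : ℕ => -q^(i+1))
    (fun i => by simpa [sub_eq_add_neg] using aux_one_sub_ne q hq i) (aux_sum q hq)
  simpa [qPochInf, sub_eq_add_neg] using this

lemma aux_tendsto (q : ℂ) (hq : ‖q‖ < 1) :
    Tendsto (qPoch q) atTop (𝓝 (qPochInf q)) := by
  have := (multipliable_one_add_of_summable (aux_sum q hq)).hasProd.tendsto_prod_nat
  simp only [← sub_eq_add_neg] at this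
  exact this

lemma aux_bound (q : ℂ) (hq : ‖q‖ < 1) : ∃ C : ℝ, 0 ≤ C ∧ (∀ n, ‖qPoch q n‖ ≤ C) ∧
    ∀ n, ‖(qPoch q n)⁻¹‖ ≤ C := by
  obtain ⟨A, hA⟩ := (aux_tendsto q hq).norm.bddAbove_range
  obtain ⟨B, hB⟩ := ((aux_tendsto q hq).inv₀ (aux_inf_ne q hq)).norm.bddAbove_range
  refine ⟨max A B, ?_, fun n => ?_, fun n => ?_⟩
  · exact (norm_nonneg (qPoch q 0)).trans ((hA ⟨0, rfl⟩).trans (le_max_left _ _))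
  · exact (hA ⟨n, rfl⟩).trans (le_max_left _ _)
  · exact (hB ⟨n, rfl⟩).trans (le_max_right _ _)

noncomputable def auxU (q : ℂ) (m n : ℕ) : ℂ := q^((m+1)*n) * ((qPoch q n)⁻¹)^2
noncomputable def auxV (q : ℂ) (m k : ℕ) : ℂ :=
  (-1)^k * q^(k*(k+1)/2) * (qPoch q (m+k) * (qPoch q k)⁻¹)
noncomputable def auxS (q : ℂ) (m : ℕ) : ℂ := ∑' n, auxU q m n
noncomputable def auxF (q : ℂ) (m : ℕ) : ℂ := ∑' n, auxV q m n

lemma aux_pow_le (q : ℂ) (hq : ‖q‖ < 1) {a b : ℕ} (h : b ≤ a) : ‖q^a‖ ≤ ‖q‖^b := by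
  rw [norm_pow]
  exact pow_le_pow_of_le_one (norm_nonneg q) hq.le h

lemma aux_tri (k : ℕ) : k ≤ k*(k+1)/2 := by
  rw [Nat.le_div_iff_mul_le (by norm_num)]
  nlinarith [Nat.zero_le k, mul_self_nonneg ((k:ℤ)), Nat.le_mul_self k]

lemma aux_tri_succ (k : ℕ) : (k+1)*(k+2)/2 = k*(k+1)/2 + (k+1) := by
  have : (k+1)*(k+2) = k*(k+1) + (k+1)*2 := by ring
  rw [this, Nat.add_mul_div_right _ _ (by norm_num)]

lemma aux_tri_add (m k : ℕ) : k ≤ (m+1)*k := by nlinarith [Nat.zero_le (m*k)]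

lemma aux_tendsto_of {f : ℕ → ℂ} {r C : ℝ} (h0 : 0 ≤ r) (h1 : r < 1)
    (h : ∀ n, ‖f n‖ ≤ r^n * C) : Tendsto f atTop (𝓝 0) := by
  apply squeeze_zero_norm h
  simpa using (tendsto_pow_atTop_nhds_zero_of_lt_one h0 h1).mul_const C

lemma aux_bdd {f g : ℕ → ℂ} {B : ℝ} (hf : ∀ n, ‖f n‖ ≤ B) (hg : Tendsto g atTop (𝓝 0)) :
    Tendsto (fun n => f n * g n) atTop (𝓝 0) := by
  apply squeeze_zero_norm (a := fun n => B * ‖g n‖)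
  · intro n
    rw [norm_mul]
    exact mul_le_mul_of_nonneg_right (hf n) (norm_nonneg _)
  · simpa using hg.norm.const_mul B

section
variable (q : ℂ) (hq : ‖q‖ < 1) (C : ℝ) (h0 : 0 ≤ C) (hP : ∀ n, ‖qPoch q n‖ ≤ C)
    (hQ : ∀ n, ‖(qPoch q n)⁻¹‖ ≤ C)

include hq hQ in
lemma auxU_le (m n : ℕ) : ‖auxU q m n‖ ≤ ‖q‖^n * C^2 := by
  unfold auxU
  rw [norm_mul, norm_pow _ 2]
  have := aux_pow_le q hq (aux_tri_add m n)
  have := hQ n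
  gcongr

include hq h0 hP hQ in
lemma auxV_le (m n : ℕ) : ‖auxV q m n‖ ≤ ‖q‖^n * C^2 := by
  unfold auxV
  rw [norm_mul, norm_mul, norm_mul, norm_pow (-1)]
  have := aux_pow_le q hq (aux_tri n)
  have := hQ n
  have := hP (m+n)
  rw [norm_neg, norm_one, one_pow, one_mul, pow_two]
  gcongr

include hq in
lemma aux_geo : Summable (fun n : ℕ => ‖q‖^n * C^2) :=
  (summable_geometric_of_lt_one (norm_nonneg q) hq).mul_right _

include hq hQ in
lemma auxU_sum (m : ℕ) : Summable (auxU q m) :=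
  (aux_geo q hq C).of_norm_bounded (auxU_le q hq C hQ m)

include hq h0 hP hQ in
lemma auxV_sum (m : ℕ) : Summable (auxV q m) :=
  (aux_geo q hq C).of_norm_bounded (auxV_le q hq C h0 hP hQ m)

include hq hQ in
lemma auxS_le (m : ℕ) : ‖auxS q m‖ ≤ ∑' n : ℕ, ‖q‖^n * C^2 :=
  tsum_of_norm_bounded (aux_geo q hq C).hasSum (auxU_le q hq C hQ m)

include hq h0 hP hQ in
lemma auxF_le (m : ℕ) : ‖auxF q m‖ ≤ ∑' n : ℕ, ‖q‖^n * C^2 :=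
  tsum_of_norm_bounded (aux_geo q hq C).hasSum (auxV_le q hq C h0 hP hQ m)

include hq hQ in
lemma auxS_diff : Tendsto (fun m => auxS q (m+1) - auxS q m) atTop (𝓝 0) := by
  have h : ∀ m, ‖auxS q (m+1) - auxS q m‖ ≤ ‖q‖^m * ∑' n : ℕ, (2 * (‖q‖^n * C^2)) := by
    intro m
    rw [← tsum_mul_left]
    unfold auxS
    rw [← (auxU_sum q hq C hQ (m+1)).tsum_sub (auxU_sum q hq C hQ m)]
    refine tsum_of_norm_bounded (((aux_geo q hq C).mul_left 2).mul_left _).hasSum ?_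
    intro n
    rcases n with _ | n
    · simp [auxU]; positivity
    · have e : auxU q (m+1) (n+1) - auxU q m (n+1)
        = q^m * (q^((m+1)*n+1) * ((qPoch q (n+1))⁻¹)^2 * (q^(n+1) - 1)) := by
        unfold auxU; ring
      rw [e, norm_mul, norm_pow q m, norm_mul, norm_mul, norm_pow _ 2]
      have a1 := aux_pow_le q hq (a := (m+1)*n+1) (b := n+1) (by have := aux_tri_add m n; omega)
      have a2 := hQ (n+1)
      have a3 : ‖q^(n+1) - 1‖ ≤ 2 := by
        refine (norm_sub_le _ _).trans ?_
        have := aux_pow_le q hq (a := n+1) (b := 0) (by omega)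
        simp at this ⊢
        linarith
      rw [mul_comm 2]
      gcongr
  exact aux_tendsto_of (norm_nonneg q) hq h

include hq h0 hP hQ in
lemma auxF_diff : Tendsto (fun m => auxF q (m+1) - auxF q m) atTop (𝓝 0) := by
  have h : ∀ m, ‖auxF q (m+1) - auxF q m‖ ≤ ‖q‖^m * ∑' n : ℕ, (‖q‖^n * C^2) := by
    intro m
    rw [← tsum_mul_left]
    unfold auxF
    rw [← (auxV_sum q hq C h0 hP hQ (m+1)).tsum_sub (auxV_sum q hq C h0 hP hQ m)]
    refine tsum_of_norm_bounded (((aux_geo q hq C)).mul_left _).hasSum ?_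
    intro n
    have e : auxV q (m+1) n - auxV q m n = - (q^m * (q^(n+1) * auxV q m n)) := by
      unfold auxV
      rw [show m+1+n = m+n+1 by ring, aux_succ]; ring
    rw [e, norm_neg, norm_mul, norm_mul, norm_pow q m]
    have a1 := aux_pow_le q hq (a := n+1) (b := 0) (by omega)
    have a2 := auxV_le q hq C h0 hP hQ m n
    have : ‖q^(n+1)‖ * ‖auxV q m n‖ ≤ ‖q‖^0 * (‖q‖^n * C^2) := by gcongr
    rw [pow_zero, one_mul] at this
    gcongr
  exact aux_tendsto_of (norm_nonneg q) hq h

include hq hQ in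
lemma auxS_rec (m : ℕ) : auxS q (m+2) = 2 * auxS q (m+1) - (1 - q^(m+1)) * auxS q m := by
  have s0 := auxU_sum q hq C hQ m
  have s1 := auxU_sum q hq C hQ (m+1)
  have s2 := auxU_sum q hq C hQ (m+2)
  have hs := (s2.sub (s1.mul_left 2)).add (s0.mul_left (1 - q^(m+1)))
  have key := aux_tele (L := 0) (g := fun n => - (auxU q m n * (1 - q^n)^2)) hs ?_ ?_
  · rw [((s2.sub (s1.mul_left 2))).tsum_add (s0.mul_left (1 - q^(m+1))),
      s2.tsum_sub (s1.mul_left 2), tsum_mul_left, tsum_mul_left] at key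
    simp at key
    unfold auxS
    linear_combination key
  · intro n
    have e1 := aux_one_sub_ne q hq n
    have e2 := aux_ne q hq n
    simp only [auxU, aux_succ]
    field_simp
    ring
  · have := ((s2.sub (s1.mul_left 2)).add s0).tendsto_atTop_zero.neg
    rw [neg_zero] at this
    refine this.congr fun n => ?_
    simp only [auxU]; ring

include hq h0 hP hQ in
lemma auxF_rec (m : ℕ) : auxF q (m+2) = 2 * auxF q (m+1) - (1 - q^(m+1)) * auxF q m := by
  have s0 := auxV_sum q hq C h0 hP hQ m
  have s1 := auxV_sum q hq C h0 hP hQ (m+1)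
  have s2 := auxV_sum q hq C h0 hP hQ (m+2)
  have hs := (s2.sub (s1.mul_left 2)).add (s0.mul_left (1 - q^(m+1)))
  have key := aux_tele (L := 0) (g := fun n => q^(m+1) * (auxV q m n * (1 - q^n))) hs ?_ ?_
  · rw [((s2.sub (s1.mul_left 2))).tsum_add (s0.mul_left (1 - q^(m+1))),
      s2.tsum_sub (s1.mul_left 2), tsum_mul_left, tsum_mul_left] at key
    simp at key
    unfold auxF
    linear_combination key
  · intro n
    have e1 := aux_one_sub_ne q hq n
    have e2 := aux_ne q hq n
    simp only [auxV]
    rw [show m+2+n = m+n+1+1 by ring, show m+1+n = m+n+1 by ring,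
      show m+(n+1) = m+n+1 by ring, show n+1+1 = n+2 by ring, aux_tri_succ, pow_add q (n*(n+1)/2)]
    simp only [aux_succ]
    field_simp
    ring
  · refine aux_tendsto_of (r := ‖q‖) (C := C^2 * 2) (norm_nonneg q) hq ?_
    intro n
    rw [norm_mul, norm_mul]
    have a0 := aux_pow_le q hq (a := m+1) (b := 0) (by omega)
    have a1 := auxV_le q hq C h0 hP hQ m n
    have a3 : ‖1 - q^n‖ ≤ 2 := by
      refine (norm_sub_le _ _).trans ?_
      have := aux_pow_le q hq (a := n) (b := 0) (by omega)
      simp at this ⊢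
      linarith
    calc _ ≤ ‖q‖^0 * ((‖q‖^n * C^2) * 2) := by gcongr
      _ = _ := by ring

include hq hQ in
lemma auxS_init : 2 * auxS q 0 - auxS q 1 = (qPochInf q ^ 2)⁻¹ := by
  have s0 := auxU_sum q hq C hQ 0
  have s1 := auxU_sum q hq C hQ 1
  have key := aux_tele (L := (qPochInf q ^ 2)⁻¹)
    (g := fun n => ((qPoch q n)⁻¹)^2 * (1 - q^n)^2) ((s0.mul_left 2).sub s1) ?_ ?_
  · rw [(s0.mul_left 2).tsum_sub s1, tsum_mul_left] at key
    simp at key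
    unfold auxS
    linear_combination key
  · intro n
    have e1 := aux_one_sub_ne q hq n
    have e2 := aux_ne q hq n
    simp only [auxU, aux_succ]
    field_simp
    ring
  · have h1 := (((aux_tendsto q hq).inv₀ (aux_inf_ne q hq)).pow 2).mul
      (((tendsto_pow_atTop_nhds_zero_of_norm_lt_one hq).const_sub 1).pow 2)
    simpa using h1

include hq h0 hP hQ in
lemma auxF_init : 2 * auxF q 0 - auxF q 1 = 1 := by
  have s0 := auxV_sum q hq C h0 hP hQ 0
  have s1 := auxV_sum q hq C h0 hP hQ 1
  have key := aux_tele (L := 0)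
    (g := fun n => - auxV q 0 n) ((s0.mul_left 2).sub s1) ?_ ?_
  · rw [(s0.mul_left 2).tsum_sub s1, tsum_mul_left] at key
    simp [auxV, qPoch] at key
    unfold auxF
    simp [auxV, qPoch]
    linear_combination key
  · intro n
    have e1 := aux_one_sub_ne q hq n
    have e2 := aux_ne q hq n
    simp only [auxV]
    rw [show 1+n = n+1 by ring, show n+1+1 = n+2 by ring, aux_tri_succ,
      pow_add q (n*(n+1)/2), zero_add, zero_add]
    simp only [aux_succ]
    field_simp
    ring
  · simpa using s0.tendsto_atTop_zero.neg

include hq h0 hP hQ in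
lemma aux_cas : auxS q 0 * auxF q 1 = auxS q 1 * auxF q 0 := by
  have hW : ∀ m, auxS q m * auxF q (m+1) - auxS q (m+1) * auxF q m
      = qPoch q m * (auxS q 0 * auxF q 1 - auxS q 1 * auxF q 0) := by
    intro m
    induction m with
    | zero => simp [qPoch]
    | succ m ih =>
      rw [auxS_rec q hq C hQ, auxF_rec q hq C h0 hP hQ, aux_succ]
      linear_combination (1 - q^(m+1)) * ih
  have l1 := (aux_tendsto q hq).mul_const (auxS q 0 * auxF q 1 - auxS q 1 * auxF q 0)
  have b1 : Tendsto (fun m => auxS q m * (auxF q (m+1) - auxF q m)) atTop (𝓝 0) :=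
    aux_bdd (auxS_le q hq C hQ) (auxF_diff q hq C h0 hP hQ)
  have b2 : Tendsto (fun m => auxF q m * (auxS q (m+1) - auxS q m)) atTop (𝓝 0) :=
    aux_bdd (auxF_le q hq C h0 hP hQ) (auxS_diff q hq C hQ)
  have l2 := b1.sub b2
  have l3 := tendsto_nhds_unique l1 (l2.congr fun m => by rw [← hW]; ring)
  rw [sub_zero] at l3
  have := (mul_eq_zero.mp l3).resolve_left (aux_inf_ne q hq)
  linear_combination this

include hq hQ in
lemma aux_main_sum (hs : Summable fun m => q^m * (qPoch q m)⁻¹ * (auxS q m)^2) :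
    ∑' m, q^m * (qPoch q m)⁻¹ * (auxS q m)^2
      = auxS q 1 * (2 * auxS q 0 - auxS q 1) / (1 - q) := by
  have hq1 : 1 - q ≠ 0 := by simpa using aux_one_sub_ne q hq 0
  have key := aux_tele (L := 0) (g := fun m => - ((q^m * auxS q m ^2
    - (auxS q (m+1) - auxS q m)^2) * (qPoch q m)⁻¹ / (1 - q))) hs ?_ ?_
  · rw [key]
    simp [qPoch]
    field_simp
    ring
  · intro m
    rw [auxS_rec q hq C hQ, aux_succ]
    have e1 := aux_one_sub_ne q hq m
    have e2 := aux_ne q hq m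
    field_simp
    ring
  · have d := auxS_diff q hq C hQ
    have b1 : Tendsto (fun m => auxS q m ^ 2 * q^m) atTop (𝓝 0) := by
      refine Tendsto.congr (fun m => ?_) (aux_bdd (auxS_le q hq C hQ)
        (aux_bdd (auxS_le q hq C hQ)
        (tendsto_pow_atTop_nhds_zero_of_norm_lt_one hq)))
      ring
    have l := (((b1.sub (d.pow 2)).mul
      ((aux_tendsto q hq).inv₀ (aux_inf_ne q hq))).div_const (1 - q)).neg
    simp only [ne_eq, OfNat.ofNat_ne_zero, not_false_eq_true, zero_pow, sub_zero, zero_mul, zero_div, neg_zero] at l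
    refine l.congr fun m => ?_
    ring

include hq h0 hQ in
lemma aux_triple : (Summable fun m => q^m * (qPoch q m)⁻¹ * (auxS q m)^2) ∧
    ∑' n : ℕ × ℕ × ℕ,
        q ^ (n.1 + n.2.1 + n.2.2 + n.1 * n.2.1 + n.2.1 * n.2.2)
          / (qPoch q n.1 ^ 2 * qPoch q n.2.1 * qPoch q n.2.2 ^ 2)
     = ∑' m, q^m * (qPoch q m)⁻¹ * (auxS q m)^2 := by
  let e : ℕ × ℕ × ℕ ≃ ℕ × ℕ × ℕ :=
    ⟨fun x => (x.2.1, x.1, x.2.2), fun x => (x.2.1, x.1, x.2.2), fun _ => rfl, fun _ => rfl⟩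
  let G : ℕ × ℕ × ℕ → ℂ := fun x =>
    q^x.1 * (qPoch q x.1)⁻¹ * (auxU q x.1 x.2.1 * auxU q x.1 x.2.2)
  have hG : Summable G := by
    have g := summable_geometric_of_lt_one (norm_nonneg q) hq
    have gg := (g.mul_of_nonneg (g.mul_of_nonneg g (fun _ => by positivity) (fun _ => by positivity))
      (fun _ => by positivity) (fun _ => by dsimp; positivity)).mul_left (C * C^2 * C^2)
    refine gg.of_norm_bounded ?_
    rintro ⟨m, a, b⟩
    simp only [G]
    rw [norm_mul, norm_mul, norm_mul, norm_pow]
    have a1 := auxU_le q hq C hQ m a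
    have a2 := auxU_le q hq C hQ m b
    have a3 := hQ m
    calc _ ≤ ‖q‖^m * C * ((‖q‖^a * C^2) * (‖q‖^b * C^2)) := by gcongr
      _ = _ := by ring
  have hin : ∀ m, ∑' x : ℕ × ℕ, G (m, x) = q^m * (qPoch q m)⁻¹ * (auxS q m)^2 := by
    intro m
    have hn : Summable fun n => ‖auxU q m n‖ := (auxU_sum q hq C hQ m).norm
    simp only [G]
    rw [tsum_mul_left, pow_two, auxS, tsum_mul_tsum_of_summable_norm hn hn]
  refine ⟨?_, ?_⟩
  · exact hG.prod.congr fun m => hin m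
  · rw [← e.tsum_eq]
    have : ∀ x, q ^ ((e x).1 + (e x).2.1 + (e x).2.2 + (e x).1 * (e x).2.1 + (e x).2.1 * (e x).2.2)
          / (qPoch q (e x).1 ^ 2 * qPoch q (e x).2.1 * qPoch q (e x).2.2 ^ 2) = G x := by
      rintro ⟨m, a, b⟩
      simp only [e, G, auxU, Equiv.coe_fn_mk]
      have h1 := aux_ne q hq m
      have h2 := aux_ne q hq a
      have h3 := aux_ne q hq b
      field_simp
      ring
    rw [tsum_congr this, hG.tsum_prod]
    exact tsum_congr hin
end

theorem stmt6 (q : ℂ) (hq : ‖q‖ < 1) :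
    ∑' n : ℕ × ℕ × ℕ,
        q ^ (n.1 + n.2.1 + n.2.2 + n.1 * n.2.1 + n.2.1 * n.2.2)
          / (qPoch q n.1 ^ 2 * qPoch q n.2.1 * qPoch q n.2.2 ^ 2)
      = (1 + 2 * ∑' n : ℕ, (-1 : ℂ) ^ (n + 1) * q ^ ((n + 1) * (n + 2) / 2))
          / ((1 - q) * qPochInf q ^ 4) := by
  obtain ⟨C, h0, hP, hQ⟩ := aux_bound q hq
  obtain ⟨hs, ht⟩ := aux_triple q hq C h0 hQ
  rw [ht, aux_main_sum q hq C hQ hs]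
  have i1 := auxS_init q hq C hQ
  have i2 := auxF_init q hq C h0 hP hQ
  have i3 := aux_cas q hq C h0 hP hQ
  have hV : ∀ k, auxV q 0 k = (-1 : ℂ)^k * q^(k*(k+1)/2) := by
    intro k
    simp [auxV, mul_inv_cancel₀ (aux_ne q hq k)]
  have i4 : auxF q 0 = 1 + ∑' n : ℕ, (-1 : ℂ) ^ (n + 1) * q ^ ((n + 1) * (n + 2) / 2) := by
    rw [auxF, (auxV_sum q hq C h0 hP hQ 0).tsum_eq_zero_add]
    congr 1
    · simp [hV]
    · exact tsum_congr fun n => hV (n+1)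
  have hq1 : 1 - q ≠ 0 := by simpa using aux_one_sub_ne q hq 0
  have hI := aux_inf_ne q hq
  have i5 : auxS q 1 = (1 + 2 * ∑' n : ℕ, (-1 : ℂ) ^ (n + 1) * q ^ ((n + 1) * (n + 2) / 2))
      * (qPochInf q ^ 2)⁻¹ := by
    rw [← i1]
    linear_combination (2 * auxS q 0 - auxS q 1) * (2 * i4 - i2) - auxS q 1 * i2 - 2 * i3
  rw [i1, i5]
  field_simp
end
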